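/- Let A be a nonsingular n×n complex matrix. The following are equivalent: (a) for every x₀ ∈ ℂⁿ, the sequence x₁, x₂, … defined by Aᵀx_{k+1} + Ax_k = 0 for k = 0, 1, 2, … (equivalently, x_{k+1} = −A⁻ᵀA x_k) is bounded; (b) A is congruent to a unitary matrix; (c) A is congruent to a real orthogonal matrix; (d) A is congruent to a Hermitian unitary matrix; (e) A is congruent to a nonsingular conjugate normal matrix. -/

import Mathlib

open Matrix

section Antiunitary
open scoped InnerProductSpace
open Module

variable {E : Type*} [NormedAddCommGroup E] [InnerProductSpace ℂ E]

/-- An antiunitary operator has, on every nonzero invariant subspace, either a fixed unit vector or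
an orthonormal pair that it swaps up to phases. -/
lemma exists_fixed_or_swapped_of_antiunitary [FiniteDimensional ℂ E]
    (T : E →ₛₗ[starRingEnd ℂ] E) (hT : ∀ x y, ⟪T x, T y⟫_ℂ = ⟪y, x⟫_ℂ)
    (W : Submodule ℂ E) (hW : W ≠ ⊥) (hTW : ∀ x ∈ W, T x ∈ W) :
    (∃ u ∈ W, ‖u‖ = 1 ∧ T u = u) ∨
    (∃ x ∈ W, ∃ y ∈ W, ∃ c : ℂ, ‖x‖ = 1 ∧ ‖y‖ = 1 ∧ ⟪x, y⟫_ℂ = 0 ∧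
      starRingEnd ℂ c * c = 1 ∧ T x = starRingEnd ℂ c • y ∧ T y = c • x) := by
  have hnorm : ∀ x, ‖T x‖ = ‖x‖ := fun x ↦ by
    rw [@norm_eq_sqrt_re_inner ℂ, @norm_eq_sqrt_re_inner ℂ, hT]
  have normalize : ∀ u ∈ W, u ≠ 0 → T u = u → ∃ u ∈ W, ‖u‖ = 1 ∧ T u = u := by
    intro u hu h0 hTu
    refine ⟨((‖u‖⁻¹ : ℝ) : ℂ) • u, W.smul_mem _ hu, ?_, ?_⟩
    · simp [norm_smul, h0]
    · rw [map_smulₛₗ, hTu, Complex.conj_ofReal]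
  have : Nontrivial W := Submodule.nontrivial_iff_ne_bot.2 hW
  obtain ⟨l, hl⟩ := End.exists_eigenvalue
    ((T.comp T : E →ₗ[ℂ] E).restrict (p := W) (q := W) (fun x hx ↦ hTW _ (hTW _ hx)))
  obtain ⟨w, hw⟩ := hl.exists_hasEigenvector
  have hw0 : (w : E) ≠ 0 := fun h ↦ hw.2 (Subtype.ext h)
  have hTTw : T (T w) = l • (w : E) := congrArg Subtype.val hw.apply_eq_smul
  obtain ⟨v, hvW, hv, hTTv⟩ : ∃ v ∈ W, ‖v‖ = 1 ∧ T (T v) = l • v := by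
    refine ⟨((‖(w : E)‖⁻¹ : ℝ) : ℂ) • (w : E), W.smul_mem _ w.2, ?_, ?_⟩
    · simp [norm_smul, hw0]
    · rw [map_smulₛₗ, map_smulₛₗ, hTTw, Complex.conj_ofReal, Complex.conj_ofReal, smul_comm]
  have hv0 : v ≠ 0 := by rintro rfl; simp at hv
  have hl1 : ‖l‖ = 1 := by
    have := congrArg norm hTTv
    rw [hnorm, hnorm, norm_smul, hv, mul_one] at this
    exact this.symm
  by_cases h1 : l = 1
  · left
    rw [h1, one_smul] at hTTv
    by_cases h : v + T v = 0
    · have hTv : T v = -v := (neg_eq_of_add_eq_zero_right h).symm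
      refine normalize (Complex.I • v) (W.smul_mem _ hvW) (by simp [hv0]) ?_
      rw [map_smulₛₗ, hTv]; simp
    · exact normalize (v + T v) (W.add_mem hvW (hTW _ hvW)) h (by rw [map_add, hTTv, add_comm])
  · right
    have hperp : ⟪v, T v⟫_ℂ = 0 := by
      have h := hT v (T v)
      rw [hTTv, inner_smul_right] at h
      have h' : (l - 1) * ⟪T v, v⟫_ℂ = 0 := by linear_combination h
      rw [← inner_conj_symm, (mul_eq_zero.1 h').resolve_left (sub_ne_zero.2 h1), map_zero]
    obtain ⟨c, hc⟩ := IsAlgClosed.exists_pow_nat_eq l (n := 2) two_pos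
    have hc1 : ‖c‖ = 1 := by
      rw [← hc, norm_pow] at hl1
      exact (pow_eq_one_iff_of_nonneg (norm_nonneg _) two_ne_zero).1 hl1
    have hcc : starRingEnd ℂ c * c = 1 := by
      rw [← Complex.normSq_eq_conj_mul_self, Complex.normSq_eq_norm_sq, hc1]; simp
    refine ⟨c • v, W.smul_mem _ hvW, T v, hTW _ hvW, c, by rw [norm_smul, hc1, hv, one_mul],
      by rw [hnorm, hv], by rw [inner_smul_left, hperp, mul_zero], hcc, map_smulₛₗ _ _ _, ?_⟩
    rw [hTTv, smul_smul, ← hc, sq]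

/-- Orthonormal families adapted to an antiunitary operator can be completed to bases. -/
lemma exists_orthonormalBasis_of_antiunitary [FiniteDimensional ℂ E]
    (T : E →ₛₗ[starRingEnd ℂ] E) (hT : ∀ x y, ⟪T x, T y⟫_ℂ = ⟪y, x⟫_ℂ)
    (P : ℂ → ℂ → Prop) (hP : P 0 0)
    (hext : ∀ W : Submodule ℂ E, W ≠ ⊥ → (∀ x ∈ W, T x ∈ W) → ∃ t : Set E, t.Nonempty ∧ t ⊆ W ∧
      Orthonormal ℂ (Subtype.val : t → E) ∧ (∀ x ∈ t, ∃ z ∈ Submodule.span ℂ t, T z = x) ∧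
      ∀ x ∈ t, ∀ y ∈ t, P ⟪x, T y⟫_ℂ ⟪y, T x⟫_ℂ)
    {n : ℕ} (hn : finrank ℂ E = n) :
    ∃ b : OrthonormalBasis (Fin n) ℂ E, ∀ i j, P ⟪b i, T (b j)⟫_ℂ ⟪b j, T (b i)⟫_ℂ := by
  classical
  have key : ∀ k ≤ n, ∃ s : Set E, k ≤ s.ncard ∧ Orthonormal ℂ (Subtype.val : s → E) ∧
      (∀ x ∈ s, ∃ z ∈ Submodule.span ℂ s, T z = x) ∧
      ∀ x ∈ s, ∀ y ∈ s, P ⟪x, T y⟫_ℂ ⟪y, T x⟫_ℂ := by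
    intro k
    induction k with
    | zero => exact fun _ ↦ ⟨∅, by simp, by simp, by simp, by simp⟩
    | succ k ih =>
      intro hk
      obtain ⟨s, hs, hso, hsT, hsP⟩ := ih (by omega)
      rcases Nat.lt_or_ge k s.ncard with h | h
      · exact ⟨s, h, hso, hsT, hsP⟩
      have hsfin : s.Finite := hso.linearIndependent.setFinite
      have hspan : (Submodule.span ℂ s)ᗮ ≠ ⊥ := by
        intro h0
        rw [Submodule.orthogonal_eq_bot_iff] at h0
        have := hsfin.fintype
        have h1 := finrank_span_le_card (R := ℂ) s
        rw [h0, finrank_top, hn, ← Set.ncard_eq_toFinset_card'] at h1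
        omega
      obtain ⟨t, htn, htW, hto, htT, htP⟩ := hext (Submodule.span ℂ s)ᗮ hspan (by
        intro y hy
        rw [Submodule.mem_orthogonal] at hy ⊢
        intro x hx
        induction hx using Submodule.span_induction with
        | mem x hx =>
          obtain ⟨z, hz, rfl⟩ := hsT x hx
          rw [hT, ← inner_conj_symm, hy z hz, map_zero]
        | zero => exact inner_zero_left _
        | add x y _ _ hx hy => rw [inner_add_left, hx, hy, add_zero]
        | smul a x _ hx => rw [inner_smul_left, hx, mul_zero])
      have htfin : t.Finite := hto.linearIndependent.setFinite
      have hspant : Submodule.span ℂ t ≤ (Submodule.span ℂ s)ᗮ := Submodule.span_le.2 htW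
      have hst : ∀ x ∈ Submodule.span ℂ s, ∀ y ∈ Submodule.span ℂ t, ⟪x, y⟫_ℂ = 0 :=
        fun x hx y hy ↦ (Submodule.mem_orthogonal _ _).1 (hspant hy) x hx
      have hst' : ∀ x ∈ Submodule.span ℂ s, ∀ y ∈ Submodule.span ℂ t, ⟪y, x⟫_ℂ = 0 :=
        fun x hx y hy ↦ by rw [← inner_conj_symm, hst x hx y hy, map_zero]
      have ss : ∀ x ∈ s, x ∈ Submodule.span ℂ s := fun x hx ↦ Submodule.subset_span hx
      have tt : ∀ x ∈ t, x ∈ Submodule.span ℂ t := fun x hx ↦ Submodule.subset_span hx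
      have hne : ∀ x ∈ s, ∀ y ∈ t, x ≠ y := by
        rintro x hx _ hy rfl
        have h0 := hst x (ss x hx) x (tt x hy)
        exact hso.ne_zero ⟨x, hx⟩ (inner_self_eq_zero.1 h0)
      have hdisj : Disjoint s t := Set.disjoint_left.2 fun x hx hy ↦ hne x hx x hy rfl
      have hcross : ∀ x ∈ s, ∀ y ∈ t, ⟪x, T y⟫_ℂ = 0 ∧ ⟪y, T x⟫_ℂ = 0 := by
        intro x hx y hy
        obtain ⟨z, hz, hzx⟩ := hsT x hx
        obtain ⟨w, hw, hwy⟩ := htT y hy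
        constructor
        · rw [← hzx, hT]; exact hst' z hz y (tt y hy)
        · rw [← hwy, hT]; exact hst x (ss x hx) w hw
      refine ⟨s ∪ t, ?_, ?_, ?_, ?_⟩
      · rw [Set.ncard_union_eq hdisj hsfin htfin]
        have := (Set.ncard_pos htfin).2 htn
        omega
      · rw [orthonormal_subtype_iff_ite] at hso hto ⊢
        rintro x (hx | hx) y (hy | hy)
        · exact hso x hx y hy
        · rw [hst x (ss x hx) y (tt y hy), if_neg (hne x hx y hy)]
        · rw [hst' y (ss y hy) x (tt x hx), if_neg (hne y hy x hx).symm]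
        · exact hto x hx y hy
      · rintro x (hx | hx)
        · obtain ⟨z, hz, h⟩ := hsT x hx
          exact ⟨z, Submodule.span_mono Set.subset_union_left hz, h⟩
        · obtain ⟨z, hz, h⟩ := htT x hx
          exact ⟨z, Submodule.span_mono Set.subset_union_right hz, h⟩
      · rintro x (hx | hx) y (hy | hy)
        · exact hsP x hx y hy
        · rwa [(hcross x hx y hy).1, (hcross x hx y hy).2]
        · rwa [(hcross y hy x hx).1, (hcross y hy x hx).2]
        · exact htP x hx y hy
  obtain ⟨s, hs, hso, -, hsP⟩ := key n le_rfl
  have := hso.linearIndependent.setFinite.fintype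
  have hcard : Fintype.card s = n := by
    refine le_antisymm (hn ▸ hso.linearIndependent.fintype_card_le_finrank) ?_
    rwa [Set.ncard_eq_toFinset_card', Set.toFinset_card] at hs
  have hspan : ⊤ ≤ Submodule.span ℂ (Set.range (Subtype.val : s → E)) :=
    (hso.linearIndependent.span_eq_top_of_card_eq_finrank' (hcard.trans hn.symm)).ge
  refine ⟨(OrthonormalBasis.mk hso hspan).reindex (Fintype.equivFinOfCardEq hcard), fun i j ↦ ?_⟩
  simp only [OrthonormalBasis.reindex_apply, OrthonormalBasis.coe_mk]
  exact hsP _ (Subtype.coe_prop _) _ (Subtype.coe_prop _)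

/-- In a suitable orthonormal basis the matrix of an antiunitary operator is Hermitian. -/
lemma exists_orthonormalBasis_hermitian_of_antiunitary [FiniteDimensional ℂ E]
    (T : E →ₛₗ[starRingEnd ℂ] E) (hT : ∀ x y, ⟪T x, T y⟫_ℂ = ⟪y, x⟫_ℂ)
    {n : ℕ} (hn : finrank ℂ E = n) :
    ∃ b : OrthonormalBasis (Fin n) ℂ E,
      ∀ i j, starRingEnd ℂ ⟪b i, T (b j)⟫_ℂ = ⟪b j, T (b i)⟫_ℂ := by
  refine exists_orthonormalBasis_of_antiunitary T hT (fun a b ↦ starRingEnd ℂ a = b) (map_zero _)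
    (fun W hW hTW ↦ ?_) hn
  rcases exists_fixed_or_swapped_of_antiunitary T hT W hW hTW with
    ⟨u, huW, hu, hTu⟩ | ⟨x, hxW, y, hyW, c, hx, hy, hxy, hc, hTx, hTy⟩
  · refine ⟨{u}, by simp, by simpa using huW, by simp [hu],
      by simpa using ⟨u, Submodule.mem_span_singleton_self u, hTu⟩, ?_⟩
    simp [hTu, hu]
  · have hyx : ⟪y, x⟫_ℂ = 0 := by rw [← inner_conj_symm, hxy, map_zero]
    have hne : x ≠ y := by rintro rfl; simp_all
    refine ⟨{x, y}, by simp, by simp [Set.insert_subset_iff, hxW, hyW],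
      ?_, ?_, ?_⟩
    · classical simp [orthonormal_subtype_iff_ite, hx, hy, hxy, hyx, hne, hne.symm]
    · simp only [Set.mem_insert_iff, Set.mem_singleton_iff, forall_eq_or_imp, forall_eq]
      refine ⟨⟨c • y, Submodule.smul_mem _ _ (Submodule.subset_span (by simp)), ?_⟩,
        ⟨starRingEnd ℂ c • x, Submodule.smul_mem _ _ (Submodule.subset_span (by simp)), ?_⟩⟩
      · rw [map_smulₛₗ, hTy, smul_smul, hc, one_smul]
      · rw [map_smulₛₗ, hTx, smul_smul, Complex.conj_conj, mul_comm, hc, one_smul]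
    · simp [hTx, hTy, inner_smul_left, hx, hy, hxy, hyx]

/-- In a suitable orthonormal basis the matrix of an antiunitary operator is real. -/
lemma exists_orthonormalBasis_real_of_antiunitary [FiniteDimensional ℂ E]
    (T : E →ₛₗ[starRingEnd ℂ] E) (hT : ∀ x y, ⟪T x, T y⟫_ℂ = ⟪y, x⟫_ℂ)
    {n : ℕ} (hn : finrank ℂ E = n) :
    ∃ b : OrthonormalBasis (Fin n) ℂ E,
      ∀ i j, starRingEnd ℂ ⟪b i, T (b j)⟫_ℂ = ⟪b i, T (b j)⟫_ℂ := by
  refine exists_orthonormalBasis_of_antiunitary T hT (fun a _ ↦ starRingEnd ℂ a = a) (map_zero _)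
    (fun W hW hTW ↦ ?_) hn
  rcases exists_fixed_or_swapped_of_antiunitary T hT W hW hTW with
    ⟨u, huW, hu, hTu⟩ | ⟨x, hxW, y, hyW, c, hx, hy, hxy, hc, hTx, hTy⟩
  · refine ⟨{u}, by simp, by simpa using huW, by simp [hu],
      by simpa using ⟨u, Submodule.mem_span_singleton_self u, hTu⟩, ?_⟩
    simp [hTu, hu]
  · have hyx : ⟪y, x⟫_ℂ = 0 := by rw [← inner_conj_symm, hxy, map_zero]
    have hxx : ⟪x, x⟫_ℂ = 1 := by simp [hx]
    have hyy : ⟪y, y⟫_ℂ = 1 := by simp [hy]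
    obtain ⟨r, hr, hrr⟩ : ∃ r : ℂ, starRingEnd ℂ r = r ∧ r * r = 1 / 2 := by
      refine ⟨((√(1 / 2) : ℝ) : ℂ), Complex.conj_ofReal _, ?_⟩
      rw [← Complex.ofReal_mul, Real.mul_self_sqrt (by norm_num)]
      simp
    have hI := Complex.I_mul_I
    set p : E := r • x + r • y with hp
    set q : E := (r * Complex.I) • x - (r * Complex.I) • y with hq
    have hTp : T p = (r * c) • x + (r * starRingEnd ℂ c) • y := by
      simp only [hp, map_add, map_smulₛₗ, hTx, hTy, hr, smul_smul]; abel
    have hTq : T q = (r * Complex.I * c) • x - (r * Complex.I * starRingEnd ℂ c) • y := by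
      simp only [hq, map_sub, map_smulₛₗ, hTx, hTy, map_mul, hr, Complex.conj_I, smul_smul]
      module
    have hpp : ⟪p, p⟫_ℂ = 1 := by
      simp only [hp, inner_add_left, inner_add_right, inner_smul_left, inner_smul_right, hxx, hyy,
        hxy, hyx, hr]
      linear_combination 2 * hrr
    have hqq : ⟪q, q⟫_ℂ = 1 := by
      simp only [hq, inner_sub_left, inner_sub_right, inner_smul_left, inner_smul_right, hxx, hyy,
        hxy, hyx, hr, map_mul, Complex.conj_I]
      linear_combination 2 * hrr - 2 * r * r * hI
    have hpq : ⟪p, q⟫_ℂ = 0 := by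
      simp only [hp, hq, inner_add_left, inner_sub_right, inner_smul_left, inner_smul_right, hxx,
        hyy, hxy, hyx, hr]
      ring
    have hqp : ⟪q, p⟫_ℂ = 0 := by rw [← inner_conj_symm, hpq, map_zero]
    have hne : p ≠ q := by intro h; rw [← h, hpp] at hpq; exact one_ne_zero hpq
    have hpspan : p ∈ Submodule.span ℂ {p, q} := Submodule.subset_span (by simp)
    have hqspan : q ∈ Submodule.span ℂ {p, q} := Submodule.subset_span (by simp)
    have hxspan : x ∈ Submodule.span ℂ {p, q} := by
      have : x = r • p + (-(r * Complex.I)) • q := by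
        rw [hp, hq]
        match_scalars
        · linear_combination -2 * hrr + r * r * hI
        · linear_combination -r * r * hI
      rw [this]
      exact add_mem (Submodule.smul_mem _ _ hpspan) (Submodule.smul_mem _ _ hqspan)
    have hyspan : y ∈ Submodule.span ℂ {p, q} := by
      have : y = r • p + (r * Complex.I) • q := by
        rw [hp, hq]
        match_scalars
        · linear_combination -2 * hrr + r * r * hI
        · linear_combination -r * r * hI
      rw [this]
      exact add_mem (Submodule.smul_mem _ _ hpspan) (Submodule.smul_mem _ _ hqspan)
    have hcs : ∀ a b : ℂ, a • x + b • y ∈ Submodule.span ℂ {p, q} := fun a b ↦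
      add_mem (Submodule.smul_mem _ _ hxspan) (Submodule.smul_mem _ _ hyspan)
    refine ⟨{p, q}, by simp, ?_, ?_, ?_, ?_⟩
    · simp only [Set.insert_subset_iff, Set.singleton_subset_iff]
      exact ⟨W.add_mem (W.smul_mem _ hxW) (W.smul_mem _ hyW),
        W.sub_mem (W.smul_mem _ hxW) (W.smul_mem _ hyW)⟩
    · classical
      rw [orthonormal_subtype_iff_ite]
      simp only [Set.mem_insert_iff, Set.mem_singleton_iff, forall_eq_or_imp, forall_eq, hpp, hqq,
        hpq, hqp, hne, hne.symm, if_true, if_false, and_self]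
    · simp only [Set.mem_insert_iff, Set.mem_singleton_iff, forall_eq_or_imp, forall_eq]
      refine ⟨⟨_, hcs (r * starRingEnd ℂ c) (r * c), ?_⟩,
        ⟨_, hcs (r * Complex.I * starRingEnd ℂ c) (-(r * Complex.I * c)), ?_⟩⟩
      · simp only [map_add, map_smulₛₗ, hTx, hTy, hp, map_mul, hr, Complex.conj_conj]
        match_scalars
        · linear_combination r * hc
        · linear_combination r * hc
      · simp only [map_add, map_smulₛₗ, hTx, hTy, hq, map_mul, map_neg, hr, Complex.conj_conj,
          Complex.conj_I]
        match_scalars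
        · linear_combination -r * Complex.I * hc
        · linear_combination r * Complex.I * hc
    · simp only [Set.mem_insert_iff, Set.mem_singleton_iff, forall_eq_or_imp, forall_eq, hTp, hTq]
      simp only [hp, hq, inner_add_left, inner_sub_left, inner_sub_right, inner_add_right,
        inner_smul_left, inner_smul_right, hxx, hyy, hxy, hyx, hr, map_mul, map_add, map_sub, map_neg,
        Complex.conj_conj, Complex.conj_I, map_zero, map_one]
      refine ⟨⟨?_, ?_⟩, ?_, ?_⟩ <;> ring

end Antiunitary

section MatrixLemmas
open scoped InnerProductSpace MatrixOrder ComplexOrder Matrix.Norms.L2Operator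
open Filter Topology

variable {n : ℕ}

/-- A matrix all of whose integer powers are bounded preserves an inner product. -/
lemma exists_invariant_inner_of_bounded_pow (C D : Matrix (Fin n) (Fin n) ℂ) (hDC : D * C = 1)
    (K : ℝ) (hC : ∀ k, ‖C ^ k‖ ≤ K) (hD : ∀ k, ‖D ^ k‖ ≤ K) :
    ∃ R : Matrix (Fin n) (Fin n) ℂ, IsUnit R.det ∧ Cᴴ * (Rᴴ * R) * C = Rᴴ * R := by
  have hK : 0 ≤ K := (norm_nonneg _).trans (hC 0)
  set P : ℕ → Matrix (Fin n) (Fin n) ℂ := fun N ↦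
    ((N + 1 : ℝ)⁻¹) • ∑ k ∈ Finset.range (N + 1), star (C ^ k) * C ^ k with hP
  have hterm : ∀ k, ‖star (C ^ k) * C ^ k‖ ≤ K * K := fun k ↦ by
    rw [CStarRing.norm_star_mul_self]
    exact mul_self_le_mul_self (norm_nonneg _) (hC k)
  have hbdd : ∀ N, ‖P N‖ ≤ K * K := fun N ↦ by
    have hN : (0 : ℝ) < N + 1 := by positivity
    rw [hP, norm_smul, norm_inv, Real.norm_of_nonneg hN.le, inv_mul_le_iff₀ hN]
    refine (norm_sum_le_of_le _ fun k _ ↦ hterm k).trans ?_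
    simp
  have hlow : ∀ k, 1 ≤ (K ^ 2) • (star (C ^ k) * C ^ k) := fun k ↦ by
    have h1 : D ^ k * C ^ k = 1 := by
      have hCD : Commute D C := by
        rw [Commute, SemiconjBy, hDC, mul_eq_one_comm.1 hDC]
      rw [← hCD.mul_pow, hDC, one_pow]
    have h2 : star (D ^ k) * D ^ k ≤ algebraMap ℝ _ (K ^ 2) :=
      (CStarAlgebra.star_mul_le_algebraMap_norm_sq).trans
        (algebraMap_mono _ (pow_le_pow_left₀ (norm_nonneg _) (hD k) 2))
    have h3 := star_left_conjugate_le_conjugate h2 (C ^ k)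
    rw [Algebra.algebraMap_eq_smul_one, mul_smul_comm, smul_mul_assoc, mul_one] at h3
    refine le_trans (le_of_eq ?_) h3
    calc (1 : Matrix (Fin n) (Fin n) ℂ) = star (D ^ k * C ^ k) * (D ^ k * C ^ k) := by simp [h1]
      _ = _ := by rw [star_mul]; simp only [mul_assoc]
  have hlowP : ∀ N, 1 ≤ (K ^ 2) • P N := fun N ↦ by
    have hN : (0 : ℝ) < N + 1 := by positivity
    have h := Finset.sum_le_sum fun k (_ : k ∈ Finset.range (N + 1)) ↦ hlow k
    rw [Finset.sum_const, Finset.card_range, ← Finset.smul_sum] at h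
    have h' := smul_le_smul_of_nonneg_left h (inv_nonneg.2 hN.le)
    rw [smul_comm _ (K ^ 2)] at h'
    refine le_trans (le_of_eq ?_) h'
    rw [← Nat.cast_smul_eq_nsmul ℝ, smul_smul]
    push_cast
    rw [inv_mul_cancel₀ hN.ne', one_smul]
  have hpos : ∀ N, 0 ≤ P N := fun N ↦
    smul_nonneg (by positivity) (Finset.sum_nonneg fun k _ ↦ star_mul_self_nonneg _)
  have hinv : ∀ N, ‖Cᴴ * P N * C - P N‖ ≤ (N + 1 : ℝ)⁻¹ * (K * K + K * K) := fun N ↦ by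
    have hN : (0 : ℝ) < N + 1 := by positivity
    have : Cᴴ * P N * C - P N =
        ((N + 1 : ℝ)⁻¹) • (star (C ^ (N + 1)) * C ^ (N + 1) - star (C ^ 0) * C ^ 0) := by
      rw [← Finset.sum_range_sub (fun k ↦ star (C ^ k) * C ^ k), Finset.sum_sub_distrib]
      simp only [hP, mul_smul_comm, smul_mul_assoc, ← smul_sub, Finset.mul_sum, Finset.sum_mul]
      congr 2
      refine Finset.sum_congr rfl fun k _ ↦ ?_
      rw [pow_succ, star_mul, Matrix.star_eq_conjTranspose C]
      simp only [mul_assoc]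
    rw [this, norm_smul, norm_inv, Real.norm_of_nonneg hN.le]
    gcongr
    exact (norm_sub_le _ _).trans (add_le_add (hterm _) (hterm _))
  have : ProperSpace (Matrix (Fin n) (Fin n) ℂ) := FiniteDimensional.proper ℂ _
  obtain ⟨L, -, φ, hφ, hL⟩ := tendsto_subseq_of_bounded
    (Metric.isBounded_closedBall (x := (0 : Matrix (Fin n) (Fin n) ℂ)) (r := K * K))
    (x := P) (fun N ↦ by simpa using hbdd N)
  have hLpos : 0 ≤ L := ge_of_tendsto' hL fun k ↦ hpos _
  have hLlow : 1 ≤ (K ^ 2) • L := ge_of_tendsto' (hL.const_smul (K ^ 2)) fun k ↦ hlowP _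
  have hLinv : Cᴴ * L * C = L := by
    rw [← sub_eq_zero]
    have h1 : Tendsto (fun k ↦ Cᴴ * P (φ k) * C - P (φ k)) atTop (𝓝 (Cᴴ * L * C - L)) :=
      ((hL.const_mul Cᴴ).mul_const C).sub hL
    refine tendsto_nhds_unique h1 (squeeze_zero_norm (fun k ↦ hinv (φ k)) ?_)
    have h2 := (tendsto_inv_atTop_zero.comp
      (tendsto_natCast_atTop_atTop.atTop_add (tendsto_const_nhds (x := (1 : ℝ))))).mul_const
      (K * K + K * K)
    rw [zero_mul] at h2
    exact h2.comp hφ.tendsto_atTop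
  obtain ⟨R, rfl⟩ := CStarAlgebra.nonneg_iff_eq_star_mul_self.1 hLpos
  refine ⟨R, ?_, hLinv⟩
  have hu := CStarAlgebra.isUnit_of_le 1 hLlow
  rw [← smul_mul_assoc, Matrix.isUnit_iff_isUnit_det, det_mul] at hu
  exact isUnit_of_mul_isUnit_right hu

lemma mul_aeval_of_semiconjBy {R A : Type*} [CommSemiring R] [Semiring A] [Algebra R A]
    {N X Y : A} (h : SemiconjBy N X Y) (p : Polynomial R) :
    SemiconjBy N (Polynomial.aeval X p) (Polynomial.aeval Y p) := by
  induction p using Polynomial.induction_on' with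
  | add p q hp hq => simpa using hp.add_right hq
  | monomial k a =>
    simp only [Polynomial.aeval_monomial]
    exact SemiconjBy.mul_right (Algebra.commutes a N).symm (h.pow_right k)

/-- A positive semidefinite matrix has a Hermitian fourth root that is a real polynomial in it. -/
lemma exists_aeval_pow_four_eq {Q : Matrix (Fin n) (Fin n) ℂ} (hQ : 0 ≤ Q) :
    ∃ p : Polynomial ℝ, (Polynomial.aeval Q p)ᴴ = Polynomial.aeval Q p ∧
      Polynomial.aeval Q p ^ 4 = Q := by
  have hsa : IsSelfAdjoint Q := .of_nonneg hQ
  have hfin : (spectrum ℝ Q).Finite := Matrix.finite_real_spectrum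
  refine ⟨Lagrange.interpolate hfin.toFinset id (fun x ↦ √(√x)), ?_, ?_⟩
  · rw [← cfc_polynomial _ Q hsa]
    exact (cfc_predicate (R := ℝ) _ Q)
  · rw [← map_pow, ← cfc_polynomial _ Q hsa]
    conv_rhs => rw [← cfc_id ℝ Q hsa]
    refine cfc_congr fun x hx ↦ ?_
    have hx0 : 0 ≤ x := spectrum_nonneg_of_nonneg hQ hx
    have := Lagrange.eval_interpolate_at_node (s := hfin.toFinset) (v := id)
      (fun x : ℝ ↦ √(√x)) (Function.injective_id.injOn) (hfin.mem_toFinset.2 hx)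
    rw [id] at this
    rw [Polynomial.eval_pow, this, id, show 4 = 2 * 2 from rfl, pow_mul,
      Real.sq_sqrt (Real.sqrt_nonneg _), Real.sq_sqrt hx0]

/-- A nonsingular conjugate normal matrix is congruent to a unitary matrix. -/
lemma exists_congruent_unitary_of_conjugate_normal {N : Matrix (Fin n) (Fin n) ℂ}
    (hN : IsUnit N.det) (h : Nᴴ * N = (N * Nᴴ).map (starRingEnd ℂ)) :
    ∃ S U : Matrix (Fin n) (Fin n) ℂ, IsUnit S.det ∧ Uᴴ * U = 1 ∧ N = S * U * Sᵀ := by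
  obtain ⟨p, hG, hG4⟩ := exists_aeval_pow_four_eq (star_mul_self_nonneg N)
  rw [Matrix.star_eq_conjTranspose] at hG hG4
  set G := Polynomial.aeval (Nᴴ * N) p with hGdef
  have hGT : G.map (starRingEnd ℂ) = Gᵀ := by
    conv_rhs => rw [← hG]
    ext i j
    simp
  have hGu : IsUnit G.det := by
    have : IsUnit (G ^ 4).det := by
      rw [hG4, det_mul, det_conjTranspose]
      exact hN.star.mul hN
    rw [det_pow] at this
    exact (isUnit_pow_iff (by norm_num)).1 this
  have hconj : Gᵀ = Polynomial.aeval (N * Nᴴ) p := by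
    rw [← hGT]
    have h1 := Polynomial.aeval_algHom_apply
      ((Complex.conjAe : ℂ →ₐ[ℝ] ℂ).mapMatrix (m := Fin n)) (N * Nᴴ) p
    have h2 : (Complex.conjAe : ℂ →ₐ[ℝ] ℂ).mapMatrix (N * Nᴴ) = Nᴴ * N := h.symm
    rw [h2, ← hGdef] at h1
    rw [h1]
    ext i j
    simp
  have hNG : N * G = Gᵀ * N := by
    rw [hconj]
    exact mul_aeval_of_semiconjBy (by simp [SemiconjBy, Matrix.mul_assoc]) p
  have hGi : (G⁻¹)ᴴ = G⁻¹ := by rw [conjTranspose_nonsing_inv, hG]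
  have hcancel : G⁻¹ * G = 1 := nonsing_inv_mul _ hGu
  have hcancel' : G * G⁻¹ = 1 := mul_nonsing_inv _ hGu
  refine ⟨Gᵀ, N * (G⁻¹ * G⁻¹), by rwa [det_transpose], ?_, ?_⟩
  · calc (N * (G⁻¹ * G⁻¹))ᴴ * (N * (G⁻¹ * G⁻¹))
        = G⁻¹ * G⁻¹ * (Nᴴ * N) * (G⁻¹ * G⁻¹) := by
          simp only [conjTranspose_mul, hGi, Matrix.mul_assoc]
      _ = G⁻¹ * (G⁻¹ * G) * G * (G * (G * G⁻¹) * G⁻¹) := by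
          rw [← hG4]; simp only [pow_succ, pow_zero, one_mul, Matrix.mul_assoc]
      _ = 1 := by simp only [hcancel, hcancel', Matrix.mul_one]
  · rw [transpose_transpose]
    calc N = N * (G * G⁻¹) * (G⁻¹ * G) := by simp only [hcancel, hcancel', Matrix.mul_one]
      _ = (N * G) * (G⁻¹ * G⁻¹) * G := by simp only [Matrix.mul_assoc]
      _ = _ := by rw [hNG]; simp only [Matrix.mul_assoc]

lemma inner_toLp_mulVec_of_unitary {U : Matrix (Fin n) (Fin n) ℂ} (hU : Uᴴ * U = 1)
    (x y : Fin n → ℂ) :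
    ⟪WithLp.toLp 2 (U *ᵥ x), WithLp.toLp 2 (U *ᵥ y)⟫_ℂ = ⟪WithLp.toLp 2 x, WithLp.toLp 2 y⟫_ℂ := by
  simp only [EuclideanSpace.inner_eq_star_dotProduct]
  rw [star_mulVec, dotProduct_comm, ← dotProduct_mulVec, mulVec_mulVec, hU, one_mulVec,
    dotProduct_comm]

lemma norm_toLp_mulVec_of_unitary {U : Matrix (Fin n) (Fin n) ℂ} (hU : Uᴴ * U = 1)
    (x : Fin n → ℂ) : ‖WithLp.toLp 2 (U *ᵥ x)‖ = ‖WithLp.toLp 2 x‖ := by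
  rw [@norm_eq_sqrt_re_inner ℂ, @norm_eq_sqrt_re_inner ℂ, inner_toLp_mulVec_of_unitary hU]

/-- The antiunitary operator `x ↦ U * conj x` attached to a unitary matrix `U`. -/
noncomputable def antiunitaryOfMatrix (U : Matrix (Fin n) (Fin n) ℂ) :
    EuclideanSpace ℂ (Fin n) →ₛₗ[starRingEnd ℂ] EuclideanSpace ℂ (Fin n) where
  toFun x := WithLp.toLp 2 (U *ᵥ star x.ofLp)
  map_add' x y := by simp [mulVec_add]
  map_smul' c x := by simp [mulVec_smul]

lemma inner_antiunitaryOfMatrix {U : Matrix (Fin n) (Fin n) ℂ} (hU : Uᴴ * U = 1)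
    (x y : EuclideanSpace ℂ (Fin n)) :
    ⟪antiunitaryOfMatrix U x, antiunitaryOfMatrix U y⟫_ℂ = ⟪y, x⟫_ℂ := by
  simp only [antiunitaryOfMatrix, LinearMap.coe_mk, AddHom.coe_mk]
  rw [inner_toLp_mulVec_of_unitary hU]
  simp [EuclideanSpace.inner_eq_star_dotProduct, dotProduct_comm]

/-- Changing the orthonormal basis of `x ↦ U * conj x` is a unitary congruence of `U`. -/
lemma exists_unitary_congruence_of_orthonormalBasis {U : Matrix (Fin n) (Fin n) ℂ}
    (hU : Uᴴ * U = 1) (b : OrthonormalBasis (Fin n) ℂ (EuclideanSpace ℂ (Fin n))) :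
    ∃ B : Matrix (Fin n) (Fin n) ℂ, IsUnit B.det ∧
      U = B * of (fun i j ↦ ⟪b i, antiunitaryOfMatrix U (b j)⟫_ℂ) * Bᵀ ∧
      (of (fun i j ↦ ⟪b i, antiunitaryOfMatrix U (b j)⟫_ℂ))ᴴ *
        of (fun i j ↦ ⟪b i, antiunitaryOfMatrix U (b j)⟫_ℂ) = 1 := by
  set B : Matrix (Fin n) (Fin n) ℂ := of fun i j ↦ (b j).ofLp i with hB
  have hBB : Bᴴ * B = 1 := by
    ext i j
    have := orthonormal_iff_ite.1 b.orthonormal i j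
    rw [EuclideanSpace.inner_eq_star_dotProduct] at this
    rw [one_apply, ← this, dotProduct_comm]
    rfl
  have hBB' : B * Bᴴ = 1 := mul_eq_one_comm.1 hBB
  have hM : of (fun i j ↦ ⟪b i, antiunitaryOfMatrix U (b j)⟫_ℂ) = Bᴴ * U * (Bᴴ)ᵀ := by
    ext i j
    rw [of_apply, EuclideanSpace.inner_eq_star_dotProduct, Matrix.mul_assoc, dotProduct_comm]
    rfl
  have hBT : (Bᴴ)ᵀ * Bᵀ = 1 := by rw [← transpose_mul, hBB', transpose_one]
  have hBT' : Bᵀ * (Bᴴ)ᵀ = 1 := by rw [← transpose_mul, hBB, transpose_one]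
  refine ⟨B, ?_, ?_, ?_⟩
  · exact (Matrix.isUnit_iff_isUnit_det _).1 (IsUnit.of_mul_eq_one_right _ hBB)
  · calc U = (B * Bᴴ) * U * ((Bᴴ)ᵀ * Bᵀ) := by rw [hBB', hBT, Matrix.one_mul, Matrix.mul_one]
      _ = _ := by rw [hM]; simp only [Matrix.mul_assoc]
  · rw [hM]
    have h1 : ((Bᴴ)ᵀ)ᴴ = Bᵀ := by ext; simp
    calc (Bᴴ * U * (Bᴴ)ᵀ)ᴴ * (Bᴴ * U * (Bᴴ)ᵀ) = Bᵀ * (Uᴴ * (B * Bᴴ) * U) * (Bᴴ)ᵀ := by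
          simp only [conjTranspose_mul, conjTranspose_conjTranspose, h1, Matrix.mul_assoc]
      _ = 1 := by rw [hBB', Matrix.mul_one, hU, Matrix.mul_one, hBT']

lemma exists_congruent_hermitian_of_unitary {U : Matrix (Fin n) (Fin n) ℂ} (hU : Uᴴ * U = 1) :
    ∃ S H : Matrix (Fin n) (Fin n) ℂ, IsUnit S.det ∧ Hᴴ = H ∧ Hᴴ * H = 1 ∧ U = S * H * Sᵀ := by
  obtain ⟨b, hb⟩ := exists_orthonormalBasis_hermitian_of_antiunitary (antiunitaryOfMatrix U)
    (inner_antiunitaryOfMatrix hU) (n := n) (by simp)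
  obtain ⟨B, hBu, hUB, hM⟩ := exists_unitary_congruence_of_orthonormalBasis hU b
  exact ⟨B, _, hBu, by ext i j; exact hb j i, hM, hUB⟩

lemma conjTranspose_map_ofReal_mul_self_eq_one_iff (Q : Matrix (Fin n) (Fin n) ℝ) :
    (Q.map Complex.ofReal)ᴴ * Q.map Complex.ofReal = 1 ↔ Qᵀ * Q = 1 := by
  have h1 : (Q.map Complex.ofReal)ᴴ * Q.map Complex.ofReal = (Qᵀ * Q).map Complex.ofReal := by
    ext i j
    simp [Matrix.mul_apply]
  rw [h1, ← Matrix.map_one Complex.ofReal Complex.ofReal_zero Complex.ofReal_one]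
  exact (Matrix.map_injective Complex.ofReal_injective).eq_iff

lemma exists_congruent_real_orthogonal_of_unitary {U : Matrix (Fin n) (Fin n) ℂ}
    (hU : Uᴴ * U = 1) :
    ∃ (S : Matrix (Fin n) (Fin n) ℂ) (Q : Matrix (Fin n) (Fin n) ℝ),
      IsUnit S.det ∧ Qᵀ * Q = 1 ∧ U = S * Q.map Complex.ofReal * Sᵀ := by
  obtain ⟨b, hb⟩ := exists_orthonormalBasis_real_of_antiunitary (antiunitaryOfMatrix U)
    (inner_antiunitaryOfMatrix hU) (n := n) (by simp)
  obtain ⟨B, hBu, hUB, hM⟩ := exists_unitary_congruence_of_orthonormalBasis hU b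
  have hQ : (of (fun i j ↦ (⟪b i, antiunitaryOfMatrix U (b j)⟫_ℂ).re)).map Complex.ofReal =
      of (fun i j ↦ ⟪b i, antiunitaryOfMatrix U (b j)⟫_ℂ) := by
    ext i j
    exact Complex.conj_eq_iff_re.1 (hb i j)
  rw [← hQ] at hM hUB
  exact ⟨B, _, hBu, (conjTranspose_map_ofReal_mul_self_eq_one_iff _).1 hM, hUB⟩

lemma map_star_mul_conjTranspose (U : Matrix (Fin n) (Fin n) ℂ) :
    (U * Uᴴ).map (starRingEnd ℂ) = (Uᴴ)ᵀ * Uᵀ := by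
  ext i j
  simp [Matrix.mul_apply]

lemma bounded_of_congruent_unitary {S U : Matrix (Fin n) (Fin n) ℂ} (hS : IsUnit S.det)
    (hU : Uᴴ * U = 1) (x : ℕ → Fin n → ℂ)
    (hx : ∀ k, (S * U * Sᵀ)ᵀ *ᵥ x (k + 1) + (S * U * Sᵀ) *ᵥ x k = 0) :
    ∃ K : ℝ, ∀ k, ‖WithLp.toLp 2 (x k)‖ ≤ K := by
  have hUT : (Uᵀ)ᴴ * Uᵀ = 1 := by
    have := congrArg transpose (mul_eq_one_comm.1 hU)
    rwa [transpose_mul, transpose_one] at this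
  have hstep : ∀ k, Uᵀ *ᵥ (Sᵀ *ᵥ x (k + 1)) = -(U *ᵥ (Sᵀ *ᵥ x k)) := fun k ↦ by
    have h := congrArg (S⁻¹ *ᵥ ·) (hx k)
    simp only [transpose_mul, transpose_transpose, mulVec_add, mulVec_mulVec, mulVec_zero] at h
    rw [Matrix.mul_assoc S U, ← Matrix.mul_assoc S⁻¹, ← Matrix.mul_assoc S⁻¹,
      nonsing_inv_mul _ hS, Matrix.one_mul, Matrix.one_mul] at h
    rw [mulVec_mulVec, mulVec_mulVec]
    exact eq_neg_of_add_eq_zero_left h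
  have hconst : ∀ k, ‖WithLp.toLp 2 (Sᵀ *ᵥ x k)‖ = ‖WithLp.toLp 2 (Sᵀ *ᵥ x 0)‖ := by
    intro k
    induction k with
    | zero => rfl
    | succ k ih =>
      rw [← ih, ← norm_toLp_mulVec_of_unitary hUT, hstep, WithLp.toLp_neg, norm_neg,
        norm_toLp_mulVec_of_unitary hU]
  refine ⟨‖(Sᵀ)⁻¹‖ * ‖WithLp.toLp 2 (Sᵀ *ᵥ x 0)‖, fun k ↦ ?_⟩
  have h := l2_opNorm_mulVec (Sᵀ)⁻¹ (WithLp.toLp 2 (Sᵀ *ᵥ x k))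
  rw [hconst] at h
  refine le_trans (le_of_eq ?_) h
  simp [mulVec_mulVec, nonsing_inv_mul _ (show IsUnit Sᵀ.det by rwa [det_transpose])]

lemma exists_congruent_conjugate_normal_of_bounded {A : Matrix (Fin n) (Fin n) ℂ}
    (hA : IsUnit A.det)
    (h : ∀ x : ℕ → (Fin n → ℂ), (∀ k, Aᵀ *ᵥ (x (k + 1)) + A *ᵥ (x k) = 0) →
      ∃ K : ℝ, ∀ k : ℕ, ‖WithLp.toLp 2 (x k)‖ ≤ K) :
    ∃ S N : Matrix (Fin n) (Fin n) ℂ, IsUnit S.det ∧ IsUnit N.det ∧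
      Nᴴ * N = (N * Nᴴ).map (starRingEnd ℂ) ∧ A = S * N * Sᵀ := by
  have hAT : IsUnit Aᵀ.det := by rwa [det_transpose]
  set C := -((Aᵀ)⁻¹ * A) with hC
  have hATC : Aᵀ * C = -A := by
    rw [hC, Matrix.mul_neg, ← Matrix.mul_assoc, mul_nonsing_inv _ hAT, Matrix.one_mul]
  have hCT : Cᵀ = -(Aᵀ * A⁻¹) := by
    rw [hC, transpose_neg, transpose_mul, transpose_nonsing_inv, transpose_transpose]
  set D := A⁻¹ * Cᵀ * A with hD
  have hDC : D * C = 1 := by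
    rw [hD, hCT, hC]
    calc _ = A⁻¹ * (Aᵀ * (A⁻¹ * A) * (Aᵀ)⁻¹) * A := by
          simp only [Matrix.mul_neg, Matrix.neg_mul, neg_neg, Matrix.mul_assoc]
      _ = 1 := by
          rw [nonsing_inv_mul _ hA, Matrix.mul_one, mul_nonsing_inv _ hAT, Matrix.mul_one,
            nonsing_inv_mul _ hA]
  have hDk : ∀ k, D ^ k = A⁻¹ * (C ^ k)ᵀ * A := fun k ↦ by
    induction k with
    | zero => simp [nonsing_inv_mul _ hA]
    | succ k ih =>
      rw [pow_succ, ih, hD, pow_succ', transpose_mul]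
      calc _ = A⁻¹ * (C ^ k)ᵀ * (A * A⁻¹) * Cᵀ * A := by simp only [Matrix.mul_assoc]
        _ = _ := by rw [mul_nonsing_inv _ hA, Matrix.mul_one, Matrix.mul_assoc A⁻¹]
  obtain ⟨K, hK⟩ : ∃ K, ∀ k, ‖C ^ k‖ ≤ K := by
    refine banach_steinhaus (g := fun k ↦ toEuclideanCLM (n := Fin n) (𝕜 := ℂ) (C ^ k))
      fun x ↦ ?_
    obtain ⟨K, hK⟩ := h (fun k ↦ (C ^ k) *ᵥ x.ofLp) fun k ↦ by
      rw [mulVec_mulVec, mulVec_mulVec, pow_succ', ← Matrix.mul_assoc, hATC, Matrix.neg_mul,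
        neg_mulVec, neg_add_cancel]
    exact ⟨K, hK⟩
  let f : Matrix (Fin n) (Fin n) ℂ →ₗ[ℂ] Matrix (Fin n) (Fin n) ℂ :=
    (LinearMap.mulLeft ℂ A⁻¹).comp ((LinearMap.mulRight ℂ A).comp
      (transposeLinearEquiv (Fin n) (Fin n) ℂ ℂ).toLinearMap)
  have hDf : ∀ k, D ^ k = f.toContinuousLinearMap (C ^ k) := fun k ↦ by
    rw [hDk, Matrix.mul_assoc]; rfl
  obtain ⟨R, hRu, hR⟩ := exists_invariant_inner_of_bounded_pow C D hDC
    (max K (‖f.toContinuousLinearMap‖ * K)) (fun k ↦ (hK k).trans (le_max_left _ _)) fun k ↦ by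
      rw [hDf]
      exact (f.toContinuousLinearMap.le_opNorm_of_le (hK k)).trans (le_max_right _ _)
  have hRR : R * R⁻¹ = 1 := mul_nonsing_inv _ hRu
  have hRR' : R⁻¹ * R = 1 := nonsing_inv_mul _ hRu
  have hRRH : (R⁻¹)ᴴ * Rᴴ = 1 := by rw [← conjTranspose_mul, hRR, conjTranspose_one]
  have hRRT : Rᵀ * (R⁻¹)ᵀ = 1 := by rw [← transpose_mul, hRR', transpose_one]
  set W := R * C * R⁻¹ with hW
  have hWW : Wᴴ * W = 1 := by
    calc Wᴴ * W = (R⁻¹)ᴴ * (Cᴴ * (Rᴴ * R) * C) * R⁻¹ := by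
          simp only [hW, conjTranspose_mul, Matrix.mul_assoc]
      _ = ((R⁻¹)ᴴ * Rᴴ) * (R * R⁻¹) := by rw [hR]; simp only [Matrix.mul_assoc]
      _ = 1 := by rw [hRRH, hRR, Matrix.one_mul]
  set N := (R⁻¹)ᵀ * A * R⁻¹ with hN
  have hNT : Nᵀ * W = -N := by
    calc Nᵀ * W = (R⁻¹)ᵀ * Aᵀ * (R⁻¹ * R) * C * R⁻¹ := by
          simp only [hN, hW, transpose_mul, transpose_transpose, Matrix.mul_assoc]
      _ = (R⁻¹)ᵀ * (Aᵀ * C) * R⁻¹ := by rw [hRR', Matrix.mul_one]; simp only [Matrix.mul_assoc]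
      _ = -N := by rw [hATC, Matrix.mul_neg, Matrix.neg_mul]
  have hRiu : IsUnit (R⁻¹).det := isUnit_nonsing_inv_det _ hRu
  refine ⟨Rᵀ, N, by rwa [det_transpose], ?_, ?_, ?_⟩
  · rw [hN, det_mul, det_mul, det_transpose]
    exact (hRiu.mul hA).mul hRiu
  · have h1 : N * Nᴴ = Nᵀ * (Nᵀ)ᴴ := by
      calc N * Nᴴ = (-N) * (-N)ᴴ := by rw [conjTranspose_neg, neg_mul_neg]
        _ = Nᵀ * (W * Wᴴ) * (Nᵀ)ᴴ := by
          rw [← hNT, conjTranspose_mul]; simp only [Matrix.mul_assoc]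
        _ = _ := by rw [mul_eq_one_comm.1 hWW, Matrix.mul_one]
    rw [h1, map_star_mul_conjTranspose]
    rfl
  · rw [transpose_transpose]
    calc A = (Rᵀ * (R⁻¹)ᵀ) * A * (R⁻¹ * R) := by rw [hRRT, hRR', Matrix.one_mul, Matrix.mul_one]
      _ = _ := by simp only [hN, Matrix.mul_assoc]

end MatrixLemmas

/-- For nonsingular `A`, the following are equivalent: (a) every sequence satisfying
`Aᵀ x_{k+1} + A x_k = 0` is bounded (in Euclidean norm); (b) `A` is congruent to a
unitary matrix; (c) `A` is congruent to a real orthogonal matrix; (d) `A` is congruent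
to a Hermitian unitary matrix; (e) `A` is congruent to a nonsingular conjugate normal
matrix. -/
theorem stmt_19 {n : ℕ} (A : Matrix (Fin n) (Fin n) ℂ) (hA : IsUnit A.det) :
    ((∀ x : ℕ → (Fin n → ℂ),
        (∀ k : ℕ, Aᵀ.mulVec (x (k + 1)) + A.mulVec (x k) = 0) →
        ∃ Cb : ℝ, ∀ k : ℕ, ‖(EuclideanSpace.equiv (Fin n) ℂ).symm (x k)‖ ≤ Cb) ↔
      (∃ S U : Matrix (Fin n) (Fin n) ℂ, IsUnit S.det ∧ Uᴴ * U = 1 ∧ A = S * U * Sᵀ)) ∧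
    ((∃ S U : Matrix (Fin n) (Fin n) ℂ, IsUnit S.det ∧ Uᴴ * U = 1 ∧ A = S * U * Sᵀ) ↔
      (∃ (S : Matrix (Fin n) (Fin n) ℂ) (Q : Matrix (Fin n) (Fin n) ℝ),
        IsUnit S.det ∧ Qᵀ * Q = 1 ∧ A = S * Q.map Complex.ofReal * Sᵀ)) ∧
    ((∃ S U : Matrix (Fin n) (Fin n) ℂ, IsUnit S.det ∧ Uᴴ * U = 1 ∧ A = S * U * Sᵀ) ↔
      (∃ S H : Matrix (Fin n) (Fin n) ℂ,
        IsUnit S.det ∧ Hᴴ = H ∧ Hᴴ * H = 1 ∧ A = S * H * Sᵀ)) ∧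
    ((∃ S U : Matrix (Fin n) (Fin n) ℂ, IsUnit S.det ∧ Uᴴ * U = 1 ∧ A = S * U * Sᵀ) ↔
      (∃ S N : Matrix (Fin n) (Fin n) ℂ, IsUnit S.det ∧ IsUnit N.det ∧
        Nᴴ * N = (N * Nᴴ).map (starRingEnd ℂ) ∧ A = S * N * Sᵀ)) := by
  have unitary_of_normal : (∃ S N : Matrix (Fin n) (Fin n) ℂ, IsUnit S.det ∧ IsUnit N.det ∧
      Nᴴ * N = (N * Nᴴ).map (starRingEnd ℂ) ∧ A = S * N * Sᵀ) →
      ∃ S U : Matrix (Fin n) (Fin n) ℂ, IsUnit S.det ∧ Uᴴ * U = 1 ∧ A = S * U * Sᵀ := by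
    rintro ⟨S, N, hS, hN, hNN, rfl⟩
    obtain ⟨R, U, hR, hU, rfl⟩ := exists_congruent_unitary_of_conjugate_normal hN hNN
    exact ⟨S * R, U, by rw [det_mul]; exact hS.mul hR, hU,
      by rw [transpose_mul]; simp only [Matrix.mul_assoc]⟩
  refine ⟨⟨fun h ↦ unitary_of_normal (exists_congruent_conjugate_normal_of_bounded hA h), ?_⟩,
    ⟨?_, ?_⟩, ⟨?_, ?_⟩, ⟨?_, unitary_of_normal⟩⟩
  · rintro ⟨S, U, hS, hU, rfl⟩ x hx
    exact bounded_of_congruent_unitary hS hU x hx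
  · rintro ⟨S, U, hS, hU, rfl⟩
    obtain ⟨R, Q, hR, hQ, rfl⟩ := exists_congruent_real_orthogonal_of_unitary hU
    exact ⟨S * R, Q, by rw [det_mul]; exact hS.mul hR, hQ,
      by rw [transpose_mul]; simp only [Matrix.mul_assoc]⟩
  · rintro ⟨S, Q, hS, hQ, rfl⟩
    exact ⟨S, _, hS, (conjTranspose_map_ofReal_mul_self_eq_one_iff Q).2 hQ, rfl⟩
  · rintro ⟨S, U, hS, hU, rfl⟩
    obtain ⟨R, H, hR, hH, hHH, rfl⟩ := exists_congruent_hermitian_of_unitary hU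
    exact ⟨S * R, H, by rw [det_mul]; exact hS.mul hR, hH, hHH,
      by rw [transpose_mul]; simp only [Matrix.mul_assoc]⟩
  · rintro ⟨S, H, hS, -, hH, rfl⟩
    exact ⟨S, H, hS, hH, rfl⟩
  · rintro ⟨S, U, hS, hU, rfl⟩
    refine ⟨S, U, hS, ?_, ?_, rfl⟩
    · exact (Matrix.isUnit_iff_isUnit_det _).1 (IsUnit.of_mul_eq_one_right _ hU)
    · rw [hU, mul_eq_one_comm.1 hU, Matrix.map_one _ (map_zero _) (map_one _)]
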